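/- arXiv:2405.08561 — 3 statements merged into one kernel-verified Lean document; each statement's English description precedes it below -/
import Mathlib

section
/- Let K be a kernel function, n ∈ ℕ, r₁,…,rₙ > 0 with R := r₁ + … + rₙ, and let J be an n-field function on ℝ that is R-admissible for K. Then for every y ∈ S^∞, F(x,t) → −∞ as x → y and |t| → ∞ jointly; that is, for every c ∈ ℝ there exist δ > 0 and T > 0 such that for all x ∈ S^∞ with ‖x − y‖ < δ and all t ∈ ℝ with |t| > T, one has F(x,t) < c. -/
open Filter Set Topology

noncomputable section

/-- A kernel function: finite on `ℝ \ {0}`, concave on `(-∞,0)` and `(0,∞)`,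
with equal one-sided limits at `0`, equal to `K 0` (real or `⊥`). -/
def IsKernel (K : ℝ → EReal) : Prop :=
  (∀ t : ℝ, t ≠ 0 → K t ≠ ⊥ ∧ K t ≠ ⊤) ∧
  ConcaveOn ℝ (Iio (0:ℝ)) (fun t => (K t).toReal) ∧
  ConcaveOn ℝ (Ioi (0:ℝ)) (fun t => (K t).toReal) ∧
  K 0 ≠ ⊤ ∧
  Tendsto K (𝓝[<] (0:ℝ)) (𝓝 (K 0)) ∧
  Tendsto K (𝓝[>] (0:ℝ)) (𝓝 (K 0))

/-- A monotone kernel: nonincreasing on `(-∞,0)`, nondecreasing on `(0,∞)`. -/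
def MonotoneKernel (K : ℝ → EReal) : Prop :=
  IsKernel K ∧ AntitoneOn K (Iio (0:ℝ)) ∧ MonotoneOn K (Ioi (0:ℝ))

/-- An `n`-field function on `ℝ`: bounded above, finite at more than `n` points. -/
def IsFieldFn (n : ℕ) (J : ℝ → EReal) : Prop :=
  (∃ c : ℝ, ∀ t, J t ≤ (c : EReal)) ∧
  (∃ S : Finset ℝ, n < S.card ∧ ∀ x ∈ S, J x ≠ ⊥)

/-- `J` is `R`-admissible for `K`: `J(t) + R·K(t) → -∞` as `|t| → ∞`. -/
def IsAdmissible (K J : ℝ → EReal) (R : ℝ) : Prop :=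
  Tendsto (fun t => J t + (R : EReal) * K t) (cocompact ℝ) (𝓝 ⊥)

/-- The sum of translates function `F(y,t) = J(t) + ∑ rⱼ K(t - yⱼ)`. -/
def SumTrans (K J : ℝ → EReal) {n : ℕ} (r y : Fin n → ℝ) (t : ℝ) : EReal :=
  J t + ∑ j, (r j : EReal) * K (t - y j)

/-- For monotone `y`, `cell y j` is `[y_j, y_{j+1}]` (with `y_0 = -∞`, `y_{n+1} = ∞`). -/
def cell {n : ℕ} (y : Fin n → ℝ) (j : Fin (n+1)) : Set ℝ :=
  {t | (∀ i : Fin n, (i : ℕ) < (j : ℕ) → y i ≤ t) ∧ (∀ i : Fin n, (j : ℕ) ≤ (i : ℕ) → t ≤ y i)}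

/-- The local maximum `mⱼ(y)` over the `j`-th cell. -/
def mloc (K J : ℝ → EReal) {n : ℕ} (r y : Fin n → ℝ) (j : Fin (n+1)) : EReal :=
  sSup (SumTrans K J r y '' cell y j)

/-- The local maximum `mⱼ^b(y)` over the `j`-th cell intersected with `[-b,b]`. -/
def mlocSeg (K J : ℝ → EReal) {n : ℕ} (r y : Fin n → ℝ) (b : ℝ) (j : Fin (n+1)) : EReal :=
  sSup (SumTrans K J r y '' (cell y j ∩ Icc (-b) b))

/-- `q` has the Mhaskar–Rakhmanov–Saff property for `(K, J, R)` (with `n` nodes). -/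
def HasMRS (K J : ℝ → EReal) (R : ℝ) (n : ℕ) (q : ℝ) : Prop :=
  ∀ r : Fin n → ℝ, (∀ j, 0 < r j) → (∑ j, r j) ≤ R →
    ∀ y : Fin n → ℝ, Monotone y →
      sSup (range (SumTrans K J r y)) = sSup (SumTrans K J r y '' Icc (-q) q)

/-- Along `+∞`, a concave function either tends to `-∞`, or its bounded translates exceed it
by at most a constant. -/
theorem ConcaveOn.tendsto_atBot_or_translate_le {k : ℝ → ℝ} (hk : ConcaveOn ℝ (Ioi 0) k)
    {M : ℝ} (hM : 0 ≤ M) :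
    Tendsto k atTop atBot ∨
      ∃ D : ℝ, ∀ t, M + 2 < t → ∀ u, |u| ≤ M → k (t - u) ≤ k t + D := by
  by_cases h : ∃ a b, 0 < a ∧ a < b ∧ k b < k a
  · left
    obtain ⟨a, b, ha, hab, hlt⟩ := h
    have hs : (k b - k a) / (b - a) < 0 := div_neg_of_neg_of_pos (by linarith) (by linarith)
    have hlin : Tendsto (fun t => k b + (k b - k a) / (b - a) * (t - b)) atTop atBot :=
      tendsto_atBot_add_const_left _ _
        ((tendsto_atTop_add_const_right _ (-b) tendsto_id).const_mul_atTop_of_neg hs)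
    refine tendsto_atBot_mono' _ ?_ hlin
    filter_upwards [eventually_gt_atTop b] with t ht
    have := hk.slope_anti_adjacent (mem_Ioi.2 ha)
      (mem_Ioi.2 (ha.trans (hab.trans ht))) hab ht
    rw [div_le_iff₀ (by linarith)] at this
    linarith
  · right
    push Not at h
    refine ⟨(M + 1) * (k 2 - k 1), fun t ht u hu => ?_⟩
    obtain ⟨hu₁, hu₂⟩ := abs_le.1 hu
    have hmono := h (t - u) (t + (M + 1)) (by linarith) (by linarith)
    have hs₁ := hk.slope_anti_adjacent (x := 1) (y := 2) (z := t)
      (mem_Ioi.2 one_pos) (mem_Ioi.2 (by linarith)) (by norm_num) (by linarith)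
    have hs₂ := hk.slope_anti_adjacent (x := 2) (y := t) (z := t + (M + 1))
      (mem_Ioi.2 two_pos) (mem_Ioi.2 (by linarith)) (by linarith) (by linarith)
    have hs := hs₂.trans hs₁
    rw [div_le_iff₀ (by linarith)] at hs
    norm_num at hs
    linarith

theorem SumTrans_neg (K J : ℝ → EReal) {n : ℕ} (r x : Fin n → ℝ) (t : ℝ) :
    SumTrans (fun s => K (-s)) (fun s => J (-s)) r (-x) (-t) = SumTrans K J r x t := by
  simp [SumTrans, sub_eq_add_neg, add_comm]

theorem SumTrans_eq_coe {K J : ℝ → EReal} {k : ℝ → ℝ} {n : ℕ} {r x : Fin n → ℝ} {t j : ℝ}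
    (hj : J t = j) (hk : ∀ i, K (t - x i) = k (t - x i)) :
    SumTrans K J r x t = ((j + ∑ i, r i * k (t - x i) : ℝ) : EReal) := by
  have hsum : ∀ s : Finset (Fin n), ((∑ i ∈ s, r i * k (t - x i) : ℝ) : EReal)
      = ∑ i ∈ s, (r i : EReal) * K (t - x i) := by
    intro s
    induction s using Finset.induction_on with
    | empty => simp
    | insert a s ha ih => simp only [Finset.sum_insert ha, EReal.coe_add, EReal.coe_mul, ih, hk]
  rw [SumTrans, hj, EReal.coe_add, hsum]

/-- If `J + R K` tends to `-∞` along `+∞`, then so do the sums of translates, uniformly over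
nodes in a bounded set. -/
theorem exists_forall_SumTrans_lt {K J : ℝ → EReal} {n : ℕ} (hn : 0 < n) {r : Fin n → ℝ}
    (hr : ∀ j, 0 < r j) (hfin : ∀ t, 0 < t → K t ≠ ⊥ ∧ K t ≠ ⊤)
    (hconc : ConcaveOn ℝ (Ioi 0) (fun t => (K t).toReal))
    {C : ℝ} (hC : ∀ t, J t ≤ (C : EReal))
    (hadm : Tendsto (fun t => J t + ((∑ j, r j : ℝ) : EReal) * K t) atTop (𝓝 ⊥))
    {M : ℝ} (hM : 0 ≤ M) (c : ℝ) :
    ∃ T : ℝ, ∀ x : Fin n → ℝ, (∀ j, |x j| ≤ M) → ∀ t, T < t →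
      SumTrans K J r x t < (c : EReal) := by
  set R := ∑ j, r j with hR
  have : Nonempty (Fin n) := ⟨⟨0, hn⟩⟩
  have hRpos : 0 < R := Finset.sum_pos (fun j _ => hr j) Finset.univ_nonempty
  set k : ℝ → ℝ := fun t => (K t).toReal
  have hKk : ∀ t, 0 < t → K t = k t := fun t ht =>
    (EReal.coe_toReal (hfin t ht).2 (hfin t ht).1).symm
  suffices H : ∃ T : ℝ, ∀ x : Fin n → ℝ, (∀ j, |x j| ≤ M) → ∀ t, T < t → ∀ j : ℝ,
      J t = j → j + ∑ i, r i * k (t - x i) < c by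
    obtain ⟨T, hT⟩ := H
    refine ⟨max T M, fun x hx t ht => ?_⟩
    rw [max_lt_iff] at ht
    by_cases hJ : J t = ⊥
    · simp [SumTrans, hJ, EReal.bot_lt_coe]
    · have hJt : J t = (J t).toReal :=
        (EReal.coe_toReal (ne_top_of_le_ne_top (EReal.coe_ne_top C) (hC t)) hJ).symm
      rw [SumTrans_eq_coe (k := k) hJt
        (fun i => hKk _ (by linarith [(abs_le.1 (hx i)).2]))]
      exact_mod_cast hT x hx t ht.1 _ hJt
  have hbound : ∀ (x : Fin n → ℝ) (t B : ℝ), (∀ i, k (t - x i) ≤ B) →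
      ∑ i, r i * k (t - x i) ≤ R * B := fun x t B h => by
    rw [hR, Finset.sum_mul]
    exact Finset.sum_le_sum fun i _ => mul_le_mul_of_nonneg_left (h i) (hr i).le
  rcases hconc.tendsto_atBot_or_translate_le hM with hbot | ⟨D, hD⟩
  · obtain ⟨T, hT⟩ := eventually_atTop.1 (hbot.eventually_le_atBot ((c - C - 1) / R))
    refine ⟨T + M, fun x hx t ht j hj => ?_⟩
    have hjC : j ≤ C := by exact_mod_cast hj ▸ hC t
    have := hbound x t _ fun i => hT _ (by linarith [(abs_le.1 (hx i)).2])
    rw [mul_div_cancel₀ _ hRpos.ne'] at this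
    linarith
  · obtain ⟨T, hT⟩ := eventually_atTop.1
      (hadm.eventually (gt_mem_nhds (EReal.bot_lt_coe (c - R * D))))
    refine ⟨max T (M + 2), fun x hx t ht j hj => ?_⟩
    rw [max_lt_iff] at ht
    have hlt := hT t ht.1.le
    rw [hj, hKk t (by linarith)] at hlt
    have hlt' : j + R * k t < c - R * D := by exact_mod_cast hlt
    have := hbound x t _ fun i => hD t ht.2 (x i) (hx i)
    linarith

/-- `F(x, t) → -∞` as `x → y` and `|t| → ∞` jointly: for every `c ∈ ℝ`
there are `δ > 0` and `T > 0` such that `F(x,t) < c` whenever `x ∈ S^∞`, `‖x - y‖ < δ`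
and `|t| > T`. -/
theorem sumTrans_joint_tendsto_bot (K J : ℝ → EReal) (hK : IsKernel K)
    (n : ℕ) (hn : 0 < n) (r : Fin n → ℝ) (hr : ∀ j, 0 < r j)
    (hJ : IsFieldFn n J) (hadm : IsAdmissible K J (∑ j, r j))
    (y : Fin n → ℝ) (hy : Monotone y) :
    ∀ c : ℝ, ∃ δ > (0 : ℝ), ∃ T > (0 : ℝ),
      ∀ x : Fin n → ℝ, Monotone x → ‖x - y‖ < δ →
        ∀ t : ℝ, T < |t| → SumTrans K J r x t < (c : EReal) := by
  intro c
  obtain ⟨hfin, hneg, hpos, -⟩ := hK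
  obtain ⟨⟨C, hC⟩, -⟩ := hJ
  have hM : 0 ≤ ‖y‖ + 1 := by positivity
  rw [IsAdmissible, cocompact_eq_atBot_atTop, tendsto_sup] at hadm
  have hneg' : ConcaveOn ℝ (Ioi 0) (fun t => (K (-t)).toReal) := by
    have h := hneg.comp_linearMap (-LinearMap.id)
    have hset : (-LinearMap.id : ℝ →ₗ[ℝ] ℝ) ⁻¹' Iio 0 = Ioi 0 := by
      ext t
      simp
    rwa [hset] at h
  obtain ⟨T₁, hT₁⟩ := exists_forall_SumTrans_lt hn hr (fun t ht => hfin t ht.ne') hpos hC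
    hadm.2 hM c
  obtain ⟨T₂, hT₂⟩ := exists_forall_SumTrans_lt (K := fun t => K (-t)) (J := fun t => J (-t))
    hn hr (fun t ht => hfin (-t) (neg_ne_zero.2 ht.ne')) hneg' (fun t => hC (-t))
    (hadm.1.comp tendsto_neg_atTop_atBot) hM c
  refine ⟨1, one_pos, max 1 (max T₁ T₂), by positivity, fun x _ hxy t ht => ?_⟩
  simp only [max_lt_iff] at ht
  have hx : ∀ j, |x j| ≤ ‖y‖ + 1 := fun j => by
    have h₁ : ‖x j‖ ≤ ‖x‖ := norm_le_pi_norm x j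
    have h₂ : ‖x‖ ≤ ‖x - y‖ + ‖y‖ := by simpa using norm_add_le (x - y) y
    rw [Real.norm_eq_abs] at h₁
    linarith
  rcases abs_cases t with ⟨h, -⟩ | ⟨h, -⟩ <;> rw [h] at ht
  · exact hT₁ x hx t ht.2.1
  · rw [← SumTrans_neg]
    exact hT₂ (-x) (fun j => by simpa using hx j) (-t) ht.2.2
end
end

section
/- Let K be a kernel function, n ∈ ℕ, r₁,…,rₙ > 0 with R := r₁ + … + rₙ, and let J be an n-field function on ℝ that is R-admissible for K. Then for every L > 0 there exists M_L ≥ L such that for every y ∈ S^L one has mⱼ^{M_L}(y) = mⱼ(y) for all j = 0,…,n; consequently sup_{t∈ℝ} F(y,t) = max_{0≤j≤n} mⱼ^{M_L}(y) and min_{0≤j≤n} mⱼ(y) = min_{0≤j≤n} mⱼ^{M_L}(y) for all y ∈ S^L. -/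
open Filter Set Topology

noncomputable section

/-- A concave function on `(0,∞)` is either nondecreasing or tends to `-∞` at `∞`. -/
lemma concaveOn_Ioi_monotoneOn_or_tendsto_atBot {k : ℝ → ℝ} (hk : ConcaveOn ℝ (Ioi 0) k) :
    MonotoneOn k (Ioi 0) ∨ Tendsto k atTop atBot := by
  by_cases hmono : MonotoneOn k (Ioi 0)
  · exact Or.inl hmono
  right
  simp only [MonotoneOn, not_forall, not_le] at hmono
  obtain ⟨a, ha, b, hb, hab, hlt⟩ := hmono
  have hab' : a < b := lt_of_le_of_ne hab (by rintro rfl; exact lt_irrefl _ hlt)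
  have hslope : (k b - k a) / (b - a) < 0 := div_neg_of_neg_of_pos (by linarith) (by linarith)
  set s := (k b - k a) / (b - a)
  have hlin : Tendsto (fun t : ℝ => k b + s * (t - b)) atTop atBot :=
    tendsto_atBot_add_const_left _ _
      ((tendsto_atTop_add_const_right atTop (-b) tendsto_id).const_mul_atTop_of_neg hslope)
  refine tendsto_atBot_mono' atTop ?_ hlin
  filter_upwards [eventually_gt_atTop b] with t ht
  have h := hk.slope_anti_adjacent ha (show t ∈ Ioi 0 from lt_trans hb ht) hab' ht
  rw [div_le_iff₀ (by linarith)] at h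
  linarith

/-- Increments of a fixed length of a concave function on `(0,∞)` are bounded above on
`[1,∞)` by the increment at `1`. -/
lemma concaveOn_Ioi_increment_le {k : ℝ → ℝ} (hk : ConcaveOn ℝ (Ioi 0) k) {L t : ℝ}
    (hL : 0 < L) (ht : 1 ≤ t) : k (t + L) - k t ≤ k (1 + L) - k 1 := by
  have hd : 0 < t + L - 1 := by linarith
  have h1 : (1 : ℝ) ∈ Ioi (0 : ℝ) := by simp
  have h2 : t + L ∈ Ioi (0 : ℝ) := by simp only [mem_Ioi]; linarith
  have hu : 0 ≤ (t - 1) / (t + L - 1) := div_nonneg (by linarith) hd.le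
  have hv : 0 ≤ L / (t + L - 1) := div_nonneg hL.le hd.le
  have huv : (t - 1) / (t + L - 1) + L / (t + L - 1) = 1 := by field_simp; ring
  have e1 := hk.2 h1 h2 hu hv huv
  have e2 := hk.2 h1 h2 hv hu (by linarith)
  simp only [smul_eq_mul, mul_one] at e1 e2
  have p1 : (t - 1) / (t + L - 1) + L / (t + L - 1) * (t + L) = 1 + L := by field_simp; ring
  have p2 : L / (t + L - 1) + (t - 1) / (t + L - 1) * (t + L) = t := by field_simp; ring
  rw [p1] at e1
  rw [p2] at e2
  have e3 : ((t - 1) / (t + L - 1) + L / (t + L - 1)) * k 1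
      + ((t - 1) / (t + L - 1) + L / (t + L - 1)) * k (t + L) = k 1 + k (t + L) := by
    rw [huv]; ring
  linarith

/-- A sum of translates with all kernel values finite, expressed through the real kernel. -/
lemma sumTrans_eq_add_coe {K J : ℝ → EReal} {n : ℕ} {r y : Fin n → ℝ} {t : ℝ}
    (hK : ∀ j, K (t - y j) ≠ ⊥ ∧ K (t - y j) ≠ ⊤) :
    SumTrans K J r y t = J t + ((∑ j, r j * (K (t - y j)).toReal : ℝ) : EReal) := by
  have hcoe : ∀ f : Fin n → ℝ, ((∑ j, f j : ℝ) : EReal) = ∑ j, (f j : EReal) :=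
    fun f => map_sum (⟨⟨Real.toEReal, EReal.coe_zero⟩, EReal.coe_add⟩ : ℝ →+ EReal) f
      Finset.univ
  rw [SumTrans, hcoe]
  congr 1
  refine Finset.sum_congr rfl fun j _ => ?_
  rw [EReal.coe_mul, EReal.coe_toReal (hK j).2 (hK j).1]

/-- Beyond a suitable point, uniformly in the nodes `y ∈ [-L,L]ⁿ`, every real `B`
is an upper bound of the sum of translates. -/
lemma eventually_sumTrans_le {K J : ℝ → EReal} {n : ℕ} {r : Fin n → ℝ}
    (hfin : ∀ t : ℝ, 0 < t → K t ≠ ⊥ ∧ K t ≠ ⊤)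
    (hconc : ConcaveOn ℝ (Ioi 0) fun t => (K t).toReal)
    (hn : 0 < n) (hr : ∀ j, 0 < r j) {c : ℝ} (hJ : ∀ t, J t ≤ (c : EReal))
    (hadm : Tendsto (fun t => J t + ((∑ j, r j : ℝ) : EReal) * K t) atTop (𝓝 ⊥))
    {L : ℝ} (hL : 0 < L) (B : ℝ) :
    ∀ᶠ t in atTop, ∀ y : Fin n → ℝ, (∀ j, y j ∈ Icc (-L) L) →
      SumTrans K J r y t ≤ (B : EReal) := by
  have : Nonempty (Fin n) := ⟨⟨0, hn⟩⟩
  have hR : 0 < ∑ j, r j := Finset.sum_pos (fun j _ => hr j) Finset.univ_nonempty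
  have hbound : ∀ {t D : ℝ} {y : Fin n → ℝ}, (∀ j, (K (t - y j)).toReal ≤ D) →
      ∑ j, r j * (K (t - y j)).toReal ≤ (∑ j, r j) * D := fun h => by
    rw [Finset.sum_mul]
    exact Finset.sum_le_sum fun j _ => mul_le_mul_of_nonneg_left (h j) (hr j).le
  rcases concaveOn_Ioi_monotoneOn_or_tendsto_atBot hconc with hmono | hbot
  · set C := (K (1 + L)).toReal - (K 1).toReal
    have hlt := hadm.eventually_lt_const
      (EReal.bot_lt_coe (B - (∑ j, r j) * C))
    filter_upwards [hlt, eventually_ge_atTop (1 + L)] with t ht htL y hy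
    have hpos : ∀ j, 0 < t - y j := fun j => by linarith [(hy j).2]
    rw [sumTrans_eq_add_coe fun j => hfin _ (hpos j)]
    have hKt := hfin t (by linarith)
    have hsum := hbound (t := t) (y := y) (D := (K t).toReal + C) fun j => by
      have h1 := hmono (hpos j) (show t + L ∈ Ioi 0 by simp only [mem_Ioi]; linarith)
        (show t - y j ≤ t + L by linarith [(hy j).1])
      have h2 := concaveOn_Ioi_increment_le hconc hL (show 1 ≤ t by linarith)
      simp only at h1 h2
      linarith
    rw [← EReal.coe_toReal hKt.2 hKt.1] at ht
    rcases eq_or_ne (J t) ⊥ with hJt | hJt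
    · simp [hJt]
    · have hJt' : J t ≠ ⊤ := ne_top_of_le_ne_top (EReal.coe_ne_top c) (hJ t)
      lift J t to ℝ using ⟨hJt', hJt⟩ with x
      norm_cast at ht ⊢
      rw [mul_add] at hsum
      linarith
  · filter_upwards [(tendsto_atTop_add_const_right atTop (-L) tendsto_id).eventually
      (eventually_forall_ge_atTop.2 (hbot.eventually_le_atBot ((B - c) / ∑ j, r j))),
      eventually_gt_atTop L] with t ht htL y hy
    rw [sumTrans_eq_add_coe fun j => hfin _ (by linarith [(hy j).2])]
    have hsum := hbound (t := t) (y := y) fun j => ht (t - y j) (by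
      simp only [id]; linarith [(hy j).2])
    rw [mul_div_cancel₀ _ hR.ne'] at hsum
    calc _ ≤ (c : EReal) + ((B - c : ℝ) : EReal) :=
          add_le_add (hJ t) (EReal.coe_le_coe_iff.2 hsum)
      _ = (B : EReal) := by norm_cast; ring

/-- To the right of a suitable `M`, values of the sum of translates are dominated, uniformly in
the nodes `y ∈ [-L,L]ⁿ`, by values in `(L,M]`. -/
lemma exists_sumTrans_dominated_right {K J : ℝ → EReal} {n : ℕ} {r : Fin n → ℝ}
    (hfin : ∀ t : ℝ, 0 < t → K t ≠ ⊥ ∧ K t ≠ ⊤)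
    (hconc : ConcaveOn ℝ (Ioi 0) fun t => (K t).toReal)
    (hn : 0 < n) (hr : ∀ j, 0 < r j) {c : ℝ} (hJ : ∀ t, J t ≤ (c : EReal))
    (hadm : Tendsto (fun t => J t + ((∑ j, r j : ℝ) : EReal) * K t) atTop (𝓝 ⊥))
    {L : ℝ} (hL : 0 < L) :
    ∃ M, L ≤ M ∧ ∀ y : Fin n → ℝ, (∀ j, y j ∈ Icc (-L) L) → ∀ t, M < t →
      SumTrans K J r y t = ⊥ ∨
        ∃ s ∈ Ioc L M, SumTrans K J r y t ≤ SumTrans K J r y s := by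
  by_cases hbot : ∀ t, L < t → J t = ⊥
  · exact ⟨L, le_rfl, fun y _ t ht => Or.inl (by simp [SumTrans, hbot t ht])⟩
  push Not at hbot
  obtain ⟨s, hs, hJs⟩ := hbot
  have hJs' : J s ≠ ⊤ := ne_top_of_le_ne_top (EReal.coe_ne_top c) (hJ s)
  set m := min (K (s - L)).toReal (K (s + L)).toReal
  obtain ⟨T, hT⟩ := eventually_atTop.1 (eventually_sumTrans_le hfin hconc hn hr hJ hadm hL
    ((J s).toReal + (∑ j, r j) * m))
  refine ⟨max s T, hs.le.trans (le_max_left _ _), fun y hy t ht => Or.inr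
    ⟨s, ⟨hs, le_max_left _ _⟩, (hT t ((le_max_right _ _).trans ht.le) y hy).trans ?_⟩⟩
  rw [sumTrans_eq_add_coe fun j => hfin _ (by linarith [(hy j).2]), EReal.coe_add,
    EReal.coe_toReal hJs' hJs]
  refine add_le_add le_rfl (EReal.coe_le_coe_iff.2 ?_)
  rw [Finset.sum_mul]
  refine Finset.sum_le_sum fun j _ => mul_le_mul_of_nonneg_left ?_ (hr j).le
  exact hconc.min_le_of_mem_Icc (show s - L ∈ Ioi 0 by simp only [mem_Ioi]; linarith)
    (show s + L ∈ Ioi 0 by simp only [mem_Ioi]; linarith)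
    ⟨by linarith [(hy j).2], by linarith [(hy j).1]⟩

/-- Reflecting kernel, field and nodes reflects the sum of translates. -/
lemma sumTrans_reflect (K J : ℝ → EReal) {n : ℕ} (r y : Fin n → ℝ) (t : ℝ) :
    SumTrans (fun t => K (-t)) (fun t => J (-t)) r (fun j => -y j) t = SumTrans K J r y (-t) := by
  simp only [SumTrans]
  congr! 4 with j
  ring_nf

/-- The cells of a monotone node system cover the real line. -/
lemma exists_mem_cell {n : ℕ} {y : Fin n → ℝ} (hy : Monotone y) (t : ℝ) :
    ∃ j, t ∈ cell y j := by
  classical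
  have hex : ∃ m : ℕ, ∀ i : Fin n, m ≤ (i : ℕ) → t ≤ y i := ⟨n, fun i hi => by omega⟩
  have hle : Nat.find hex ≤ n := Nat.find_min' hex fun i hi => by omega
  refine ⟨⟨Nat.find hex, by omega⟩, fun i hi => ?_, Nat.find_spec hex⟩
  by_contra! hlt
  exact Nat.find_min hex hi fun i' hi' => hlt.le.trans (hy hi')

/-- for every `L > 0` there is `M_L ≥ L` such that for all `y ∈ S^L`
the unbounded local maxima `mⱼ(y)` are already attained on `[-M_L, M_L]`:
`mⱼ^{M_L}(y) = mⱼ(y)` for all `j`; consequently the global sup equals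
`max_j mⱼ^{M_L}(y)` and `min_j mⱼ(y) = min_j mⱼ^{M_L}(y)`. -/
theorem local_maxima_on_segment (K J : ℝ → EReal) (hK : IsKernel K)
    (n : ℕ) (hn : 0 < n) (r : Fin n → ℝ) (hr : ∀ j, 0 < r j)
    (hJ : IsFieldFn n J) (hadm : IsAdmissible K J (∑ j, r j)) :
    ∀ L > (0 : ℝ), ∃ M : ℝ, L ≤ M ∧
      ∀ y : Fin n → ℝ, Monotone y → (∀ j, y j ∈ Icc (-L) L) →
        (∀ j : Fin (n + 1), mlocSeg K J r y M j = mloc K J r y j) ∧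
        sSup (range (SumTrans K J r y)) = (⨆ j : Fin (n + 1), mlocSeg K J r y M j) ∧
        (⨅ j : Fin (n + 1), mloc K J r y j) = (⨅ j : Fin (n + 1), mlocSeg K J r y M j) := by
  intro L hL
  obtain ⟨hfin, hneg, hpos, -⟩ := hK
  obtain ⟨⟨c, hc⟩, -⟩ := hJ
  rw [IsAdmissible, cocompact_eq_atBot_atTop, tendsto_sup] at hadm
  obtain ⟨M₁, hLM₁, hM₁⟩ := exists_sumTrans_dominated_right (fun t ht => hfin t ht.ne') hpos hn hr
    hc hadm.2 hL
  have hneg' : ConcaveOn ℝ (Ioi (0 : ℝ)) fun t => (K (-t)).toReal := by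
    have h := hneg.comp_linearMap (-LinearMap.id : ℝ →ₗ[ℝ] ℝ)
    have hset : (-LinearMap.id : ℝ →ₗ[ℝ] ℝ) ⁻¹' Iio 0 = Ioi 0 := by ext; simp
    rw [hset] at h
    exact h
  obtain ⟨M₂, hLM₂, hM₂⟩ := exists_sumTrans_dominated_right (K := fun t => K (-t))
    (J := fun t => J (-t)) (fun t ht => hfin (-t) (by linarith : -t < 0).ne) hneg' hn hr
    (fun t => hc (-t)) (hadm.1.comp tendsto_neg_atTop_atBot) hL
  refine ⟨max M₁ M₂, hLM₁.trans (le_max_left _ _), fun y hmono hy => ?_⟩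
  have hseg : ∀ j, mlocSeg K J r y (max M₁ M₂) j = mloc K J r y j := by
    intro j
    refine le_antisymm (sSup_le_sSup (image_mono inter_subset_left)) (sSup_le ?_)
    rintro _ ⟨t, ht, rfl⟩
    rcases lt_or_ge (max M₁ M₂) t with hlt | hle
    · rcases hM₁ y hy t ((le_max_left _ _).trans_lt hlt) with h | ⟨s, hs, hts⟩
      · simp [h]
      · refine hts.trans (le_sSup ⟨s, ⟨⟨fun i _ => (hy i).2.trans hs.1.le, fun i hi => ?_⟩,
          by linarith [hs.1, le_max_left M₁ M₂], hs.2.trans (le_max_left _ _)⟩, rfl⟩)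
        linarith [ht.2 i hi, (hy i).2, le_max_left M₁ M₂]
    rcases lt_or_ge t (-max M₁ M₂) with hlt | hge
    · have h := hM₂ (fun j => -y j) (fun j => ⟨by linarith [(hy j).2], by linarith [(hy j).1]⟩)
        (-t) (by linarith [le_max_right M₁ M₂])
      simp only [sumTrans_reflect, neg_neg] at h
      rcases h with h | ⟨s, hs, hts⟩
      · simp [h]
      · refine hts.trans (le_sSup ⟨-s, ⟨⟨fun i hi => ?_, fun i _ => by linarith [(hy i).1, hs.1]⟩,
          by linarith [hs.2, le_max_right M₁ M₂], by linarith [hs.1, le_max_right M₁ M₂]⟩, rfl⟩)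
        linarith [ht.1 i hi, (hy i).1, le_max_right M₁ M₂]
    · exact le_sSup ⟨t, ⟨ht, hge, hle⟩, rfl⟩
  refine ⟨hseg, ?_, by simp only [hseg]⟩
  simp only [hseg]
  refine le_antisymm (sSup_le ?_) (iSup_le fun j => sSup_le_sSup (image_subset_range _ _))
  rintro _ ⟨t, rfl⟩
  obtain ⟨j, hj⟩ := exists_mem_cell hmono t
  exact (le_sSup ⟨t, hj, rfl⟩ : _ ≤ mloc K J r y j).trans (le_iSup (mloc K J r y) j)
end
end

section
/- Let K be a monotone kernel function, n ∈ ℕ, r₁,…,rₙ > 0 with R := r₁ + … + rₙ, and let J be an n-field function on ℝ that is R-admissible for K. Then there exists L > 0 such that m(S^∞) = m(S^L), where m(S^L) := sup_{y ∈ S^L} min_{0≤j≤n} mⱼ(y). -/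
open Filter Set Topology

noncomputable section

/-- The half-line part of a monotone kernel: finite, concave and nondecreasing on `(0,∞)`, and
right-continuous at `0` (as an extended real valued function). -/
structure IsRightKernel (K : ℝ → EReal) : Prop where
  ne_bot : ∀ t > 0, K t ≠ ⊥
  ne_top : ∀ t > 0, K t ≠ ⊤
  concaveOn : ConcaveOn ℝ (Ioi (0:ℝ)) fun t => (K t).toReal
  monotoneOn : MonotoneOn K (Ioi (0:ℝ))
  tendsto_zero : Tendsto K (𝓝[>] (0:ℝ)) (𝓝 (K 0))

lemma ConcaveOn.exists_supporting_line {S : Set ℝ} {f : ℝ → ℝ} (hf : ConcaveOn ℝ S f) {s : ℝ}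
    (hs : s ∈ interior S) : ∃ p : ℝ, ∀ x ∈ S, f x ≤ f s + p * (x - s) := by
  have hg : ConvexOn ℝ S (-f) := hf.neg
  have hsS : s ∈ S := interior_subset hs
  refine ⟨-derivWithin (-f) (Ioi s) s, fun x hx => ?_⟩
  rcases lt_trichotomy x s with h | rfl | h
  · have h1 := hg.slope_le_leftDeriv_of_mem_interior hx hs h
    have h2 := h1.trans (hg.leftDeriv_le_rightDeriv_of_mem_interior hs)
    rw [slope_def_field, div_le_iff₀ (by linarith)] at h2
    simp only [Pi.neg_apply] at h2
    linarith
  · simp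
  · have h2 := hg.rightDeriv_le_slope_of_mem_interior hs hx h
    rw [slope_def_field, le_div_iff₀ (by linarith)] at h2
    simp only [Pi.neg_apply] at h2
    linarith

lemma EReal.coe_finsetSum {ι : Type*} (s : Finset ι) (f : ι → ℝ) :
    ((∑ i ∈ s, f i : ℝ) : EReal) = ∑ i ∈ s, (f i : EReal) := by
  classical
  induction s using Finset.induction_on with
  | empty => simp
  | insert a s ha ih => rw [Finset.sum_insert ha, Finset.sum_insert ha, EReal.coe_add, ih]

namespace IsRightKernel

variable {K : ℝ → EReal}

lemma coe_toReal (hK : IsRightKernel K) {t : ℝ} (ht : 0 < t) : ((K t).toReal : EReal) = K t :=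
  EReal.coe_toReal (hK.ne_top t ht) (hK.ne_bot t ht)

lemma exists_supporting_line (hK : IsRightKernel K) {s : ℝ} (hs : 0 < s) :
    ∃ p ≥ (0:ℝ), ∀ x ≥ 0, K x ≤ (((K s).toReal + p * (x - s) : ℝ) : EReal) := by
  obtain ⟨p, hp⟩ := hK.concaveOn.exists_supporting_line (s := s) (by simpa using hs)
  have hpos : ∀ x > 0, K x ≤ (((K s).toReal + p * (x - s) : ℝ) : EReal) := fun x hx => by
    rw [← hK.coe_toReal hx]
    exact EReal.coe_le_coe_iff.2 (hp x hx)
  refine ⟨p, ?_, fun x hx => ?_⟩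
  · have h := (hK.monotoneOn hs (show s + 1 ∈ Ioi (0:ℝ) from by simp; linarith)
      (by linarith)).trans (hpos (s + 1) (by linarith))
    rw [← hK.coe_toReal hs, EReal.coe_le_coe_iff, EReal.toReal_coe] at h
    linarith
  · rcases hx.lt_or_eq with hx | rfl
    · exact hpos x hx
    · refine le_of_tendsto_of_tendsto hK.tendsto_zero
        (g := fun x : ℝ => (((K s).toReal + p * (x - s) : ℝ) : EReal)) ?_ ?_
      · refine (continuous_coe_real_ereal.comp ?_).continuousAt.tendsto.mono_left nhdsWithin_le_nhds
        fun_prop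
      · filter_upwards [self_mem_nhdsWithin] with x hx using hpos x hx

/-- Jensen's inequality for translates: if the weighted mean of the nodes is nonnegative, then to
the right of all nodes the kernel sum is dominated by the kernel centred at `0`. -/
lemma sum_translates_le (hK : IsRightKernel K) {ι : Type*} [Fintype ι] {r y : ι → ℝ}
    (hr : ∀ j, 0 < r j) (hy : 0 ≤ ∑ j, r j * y j) {t : ℝ} (ht : 0 < t) (hyt : ∀ j, y j ≤ t) :
    ∑ j, (r j : EReal) * K (t - y j) ≤ ((∑ j, r j : ℝ) : EReal) * K t := by
  obtain ⟨p, hp0, hp⟩ := hK.exists_supporting_line ht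
  calc ∑ j, (r j : EReal) * K (t - y j)
      ≤ ∑ j, ((r j * ((K t).toReal + p * (t - y j - t)) : ℝ) : EReal) := by
        refine Finset.sum_le_sum fun j _ => ?_
        rw [EReal.coe_mul]
        exact mul_le_mul_of_nonneg_left (hp _ (sub_nonneg.2 (hyt j)))
          (EReal.coe_nonneg.2 (hr j).le)
    _ = (((∑ j, r j) * (K t).toReal - p * ∑ j, r j * y j : ℝ) : EReal) := by
        rw [← EReal.coe_finsetSum, Finset.sum_mul, Finset.mul_sum, ← Finset.sum_sub_distrib]
        congr 1
        exact Finset.sum_congr rfl fun j _ => by ring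
    _ ≤ (((∑ j, r j) * (K t).toReal : ℝ) : EReal) :=
        EReal.coe_le_coe_iff.2 (sub_le_self _ (mul_nonneg hp0 hy))
    _ = _ := by rw [EReal.coe_mul, hK.coe_toReal ht]

end IsRightKernel

lemma MonotoneKernel.isRightKernel {K : ℝ → EReal} (hK : MonotoneKernel K) : IsRightKernel K where
  ne_bot t ht := (hK.1.1 t ht.ne').1
  ne_top t ht := (hK.1.1 t ht.ne').2
  concaveOn := hK.1.2.2.1
  monotoneOn := hK.2.2
  tendsto_zero := hK.1.2.2.2.2.2

lemma MonotoneKernel.comp_neg {K : ℝ → EReal} (hK : MonotoneKernel K) :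
    MonotoneKernel fun t => K (-t) := by
  obtain ⟨⟨hfin, hcl, hcr, h0, hl, hr⟩, hanti, hmono⟩ := hK
  refine ⟨⟨fun t ht => hfin _ (neg_ne_zero.2 ht), ?_, ?_, by simpa using h0, ?_, ?_⟩, ?_, ?_⟩
  · convert hcr.comp_linearMap (-LinearMap.id) using 1 <;> ext x <;> simp
  · convert hcl.comp_linearMap (-LinearMap.id) using 1 <;> ext x <;> simp
  · simpa [Function.comp_def] using hr.comp (by simpa using tendsto_neg_nhdsLT (a := (0:ℝ)))
  · simpa [Function.comp_def] using hl.comp (by simpa using tendsto_neg_nhdsGT (a := (0:ℝ)))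
  · exact fun a ha b hb hab => hmono (by simpa using hb) (by simpa using ha) (neg_le_neg hab)
  · exact fun a ha b hb hab => hanti (by simpa using hb) (by simpa using ha) (neg_le_neg hab)

/-- Some node system has all of its local maxima above `-∞`: interlace the nodes with `n + 1` points
at which the field is finite. -/
lemma exists_monotone_bot_lt_iInf_mloc {K J : ℝ → EReal} (hK : IsKernel K) {n : ℕ}
    (r : Fin n → ℝ) (hJ : IsFieldFn n J) :
    ∃ y : Fin n → ℝ, Monotone y ∧ ⊥ < ⨅ j : Fin (n + 1), mloc K J r y j := by
  obtain ⟨-, S, hS, hfin⟩ := hJ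
  let x := S.orderEmbOfCardLe (k := n + 1) hS
  have hx : ∀ i j : Fin (n + 1), i < j → x i < x j := fun i j h => x.strictMono h
  have hxle : ∀ i j : Fin (n + 1), i ≤ j → x i ≤ x j := fun i j h => x.monotone h
  let y : Fin n → ℝ := fun i => (x i.castSucc + x i.succ) / 2
  have hleft : ∀ (i : Fin n) (j : Fin (n + 1)), (i : ℕ) < j → y i < x j := fun i j h => by
    have h1 := hx i.castSucc i.succ Fin.castSucc_lt_succ
    have h2 := hxle i.succ j (by rw [Fin.le_def, Fin.val_succ]; omega)
    simp only [y]
    linarith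
  have hright : ∀ (i : Fin n) (j : Fin (n + 1)), (j : ℕ) ≤ i → x j < y i := fun i j h => by
    have h1 := hx i.castSucc i.succ Fin.castSucc_lt_succ
    have h2 := hxle j i.castSucc (by rw [Fin.le_def, Fin.val_castSucc]; omega)
    simp only [y]
    linarith
  refine ⟨y, fun i j hij => ?_, ?_⟩
  · have h1 := hxle i.castSucc j.castSucc hij
    have h2 := hxle i.succ j.succ (Fin.succ_le_succ_iff.2 hij)
    simp only [y]
    linarith
  · obtain ⟨j, hj⟩ := exists_eq_ciInf_of_finite (f := fun j : Fin (n + 1) => mloc K J r y j)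
    rw [← hj]
    have hmem : x j ∈ cell y j := ⟨fun i h => (hleft i j h).le, fun i h => (hright i j h).le⟩
    refine lt_of_lt_of_le (bot_lt_iff_ne_bot.2 ?_) (le_sSup (mem_image_of_mem _ hmem))
    have hne : ∀ i, x j - y i ≠ 0 := fun i => sub_ne_zero.2 <| by
      rcases lt_or_ge (i : ℕ) j with h | h
      · exact (hleft i j h).ne'
      · exact (hright i j h).ne
    have hsum : ∑ i, (r i : EReal) * K (x j - y i)
        = ((∑ i, r i * (K (x j - y i)).toReal : ℝ) : EReal) := by
      rw [EReal.coe_finsetSum]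
      refine Finset.sum_congr rfl fun i _ => ?_
      rw [EReal.coe_mul, EReal.coe_toReal (hK.1 _ (hne i)).2 (hK.1 _ (hne i)).1]
    rw [SumTrans, hsum, Ne, EReal.add_eq_bot_iff]
    exact not_or.2 ⟨hfin _ (S.orderEmbOfCardLe_mem _ j), EReal.coe_ne_bot _⟩

/-- If the weighted mean of `y` is nonnegative and `y j ≤ M` for all `j`, then `y j` is bounded
in absolute value in terms of `M` and the weights. -/
lemma abs_le_of_sum_mul_nonneg {ι : Type*} [Fintype ι] {r y : ι → ℝ} (hr : ∀ j, 0 < r j) {M : ℝ}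
    (hM : 0 ≤ M) (hy : 0 ≤ ∑ j, r j * y j) (hyM : ∀ j, y j ≤ M) (j : ι) :
    |y j| ≤ M + ∑ i, (∑ k, r k) * M / r i := by
  have hR : 0 ≤ ∑ k, r k := Finset.sum_nonneg fun k _ => (hr k).le
  have hterm : ∀ i, 0 ≤ (∑ k, r k) * M / r i := fun i => div_nonneg (mul_nonneg hR hM) (hr i).le
  have hsingle := Finset.single_le_sum (fun i _ => hterm i) (Finset.mem_univ j)
  have h1 : r j * (M - y j) ≤ ∑ k, r k * (M - y k) :=
    Finset.single_le_sum (f := fun k => r k * (M - y k))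
      (fun k _ => mul_nonneg (hr k).le (sub_nonneg.2 (hyM k))) (Finset.mem_univ j)
  simp only [mul_sub, Finset.sum_sub_distrib, ← Finset.sum_mul] at h1
  have h2 : -y j ≤ (∑ k, r k) * M / r j := by
    rw [le_div_iff₀ (hr j)]
    nlinarith [mul_nonneg (hr j).le hM]
  rw [abs_le]
  constructor <;> linarith [hyM j, hterm j]

/-- A node far to the right forces the last local maximum to be small when the weighted mean of the
nodes is nonnegative. -/
lemma mloc_last_le {K J : ℝ → EReal} (hK : MonotoneKernel K) {n : ℕ} {r y : Fin n → ℝ}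
    (hr : ∀ j, 0 < r j) {M : ℝ} (hM : 0 ≤ M) {c : EReal}
    (hc : ∀ t > M, J t + ((∑ j, r j : ℝ) : EReal) * K t ≤ c)
    (hy : 0 ≤ ∑ j, r j * y j) {i : Fin n} (hi : M < y i) : mloc K J r y (Fin.last n) ≤ c := by
  refine sSup_le ?_
  rintro _ ⟨t, ht, rfl⟩
  have hyt : ∀ j, y j ≤ t := fun j => ht.1 j (by simp)
  have htM : M < t := hi.trans_le (hyt i)
  refine le_trans ?_ (hc t htM)
  rw [SumTrans]
  gcongr
  exact hK.isRightKernel.sum_translates_le hr hy (hM.trans_lt htM) hyt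

/-- A node far to the left forces the first local maximum to be small when the weighted mean of the
nodes is nonpositive. -/
lemma mloc_zero_le {K J : ℝ → EReal} (hK : MonotoneKernel K) {n : ℕ} {r y : Fin n → ℝ}
    (hr : ∀ j, 0 < r j) {M : ℝ} (hM : 0 ≤ M) {c : EReal}
    (hc : ∀ t < -M, J t + ((∑ j, r j : ℝ) : EReal) * K t ≤ c)
    (hy : ∑ j, r j * y j ≤ 0) {i : Fin n} (hi : y i < -M) : mloc K J r y 0 ≤ c := by
  refine sSup_le ?_
  rintro _ ⟨t, ht, rfl⟩
  have hyt : ∀ j, t ≤ y j := fun j => ht.2 j (by simp)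
  have htM : t < -M := (hyt i).trans_lt hi
  refine le_trans ?_ (hc t htM)
  rw [SumTrans]
  gcongr
  have h := hK.comp_neg.isRightKernel.sum_translates_le (y := fun j => -y j) (t := -t) hr
    (by simpa using hy) (by linarith) (fun j => neg_le_neg (hyt j))
  simpa only [neg_sub_neg, neg_sub, neg_neg] using h

/-- there exists `L > 0` with `m(S^∞) = m(S^L)`, i.e. the maximin over
the unbounded simplex equals the maximin over the nodes confined to `[-L, L]`. -/
theorem maximin_reduces_to_compact (K J : ℝ → EReal) (hK : MonotoneKernel K)
    (n : ℕ) (hn : 0 < n) (r : Fin n → ℝ) (hr : ∀ j, 0 < r j)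
    (hJ : IsFieldFn n J) (hadm : IsAdmissible K J (∑ j, r j)) :
    ∃ L > (0 : ℝ),
      sSup ((fun y : Fin n → ℝ => ⨅ j : Fin (n + 1), mloc K J r y j) ''
          {y | Monotone y}) =
        sSup ((fun y : Fin n → ℝ => ⨅ j : Fin (n + 1), mloc K J r y j) ''
          {y | Monotone y ∧ ∀ j, y j ∈ Icc (-L) L}) := by
  obtain ⟨y₀, hy₀, hbot⟩ := exists_monotone_bot_lt_iInf_mloc hK.1 r hJ
  set c := ⨅ j : Fin (n + 1), mloc K J r y₀ j
  have hev := hadm.eventually (gt_mem_nhds hbot)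
  rw [cocompact_eq_atBot_atTop, eventually_sup, eventually_atBot, eventually_atTop] at hev
  obtain ⟨⟨a, ha⟩, ⟨b, hb⟩⟩ := hev
  set M := max 1 (max (-a) b)
  have hM1 : 1 ≤ M := le_max_left _ _
  have hM : 0 ≤ M := by linarith
  have haM : -M ≤ a := by linarith [(le_max_left (-a) b).trans (le_max_right 1 _)]
  have hbM : b ≤ M := (le_max_right (-a) b).trans (le_max_right 1 _)
  have hR : 0 ≤ ∑ k, r k := Finset.sum_nonneg fun k _ => (hr k).le
  have hN : 0 ≤ ∑ i, (∑ k, r k) * M / r i :=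
    Finset.sum_nonneg fun i _ => div_nonneg (mul_nonneg hR hM) (hr i).le
  have hY : 0 ≤ ∑ i, |y₀ i| := Finset.sum_nonneg fun i _ => abs_nonneg _
  refine ⟨M + ∑ i, (∑ k, r k) * M / r i + ∑ i, |y₀ i|, by linarith, le_antisymm ?_
    (sSup_le_sSup (image_mono fun y hy => hy.1))⟩
  refine sSup_le ?_
  rintro _ ⟨y, hy, rfl⟩
  by_cases hyL : ∀ j, |y j| ≤ M + ∑ i, (∑ k, r k) * M / r i
  · refine le_sSup (mem_image_of_mem _ ⟨hy, fun j => ?_⟩)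
    rw [mem_Icc, ← abs_le]
    linarith [hyL j]
  · refine le_trans (b := c) ?_ (le_sSup (mem_image_of_mem _ ⟨hy₀, fun j => ?_⟩))
    · rcases le_total 0 (∑ j, r j * y j) with h | h
      · have : ∃ i, M < y i := by
          by_contra! hcon
          exact hyL (abs_le_of_sum_mul_nonneg hr hM h hcon)
        obtain ⟨i, hi⟩ := this
        exact (iInf_le _ _).trans
          (mloc_last_le hK hr hM (fun t ht => (hb t (hbM.trans ht.le)).le) h hi)
      · have : ∃ i, y i < -M := by
          by_contra! hcon
          refine hyL fun j => ?_
          simpa using abs_le_of_sum_mul_nonneg (y := fun j => -y j) hr hM (by simpa using h)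
            (fun j => neg_le.1 (hcon j)) j
        obtain ⟨i, hi⟩ := this
        exact (iInf_le _ _).trans
          (mloc_zero_le hK hr hM (fun t ht => (ha t (ht.le.trans haM)).le) h hi)
    · rw [mem_Icc, ← abs_le]
      linarith [Finset.single_le_sum (fun i _ => abs_nonneg (y₀ i)) (Finset.mem_univ j)]
end
end
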